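/- arXiv:2107.05289 — 5 statements merged into one kernel-verified Lean document; each statement's English description precedes it below -/
import Mathlib

section
/- Let μ > 0, λ > 0, T > 0 be real numbers and N ≥ 1 a natural number. For any positive reals Δt_1, …, Δt_N with ∑_{i=1}^N Δt_i ≤ T, the total expected payoff satisfies ∑_{i=1}^N (μ − λ/Δt_i) ≤ μ²T/(4λ). That is, no sampling schedule over horizon T can exceed the oracle payoff P*(T) = μ²T/(4λ). -/
/-- The payoff of a single sample after a gap `d` is at most `μ²d/(4λ)`. -/
theorem sub_div_le_sq_mul_div {μ lam d : ℝ} (hlam : 0 < lam) (hd : 0 < d) :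
    μ - lam / d ≤ μ ^ 2 * d / (4 * lam) := by
  have h : μ ^ 2 * d / (4 * lam) - (μ - lam / d) = (μ * d - 2 * lam) ^ 2 / (4 * lam * d) := by
    field_simp
    ring
  have h' : 0 ≤ (μ * d - 2 * lam) ^ 2 / (4 * lam * d) := by positivity
  linarith

/-- No sampling schedule over horizon `T` can exceed the oracle payoff: for positive
gaps `Δt i` summing to at most `T`, `∑ (μ − λ/Δt i) ≤ μ²T/(4λ)`. -/
theorem stmt_3 (μ lam T : ℝ) (hμ : 0 < μ) (hlam : 0 < lam) (hT : 0 < T)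
    (N : ℕ) (hN : 1 ≤ N) (Δt : Fin N → ℝ) (hΔt : ∀ i, 0 < Δt i)
    (hsum : ∑ i, Δt i ≤ T) :
    ∑ i, (μ - lam / Δt i) ≤ μ ^ 2 * T / (4 * lam) := by
  calc ∑ i, (μ - lam / Δt i) ≤ ∑ i, μ ^ 2 * Δt i / (4 * lam) :=
        Finset.sum_le_sum fun i _ => sub_div_le_sq_mul_div hlam (hΔt i)
    _ = μ ^ 2 * (∑ i, Δt i) / (4 * lam) := by rw [Finset.mul_sum, Finset.sum_div]
    _ ≤ μ ^ 2 * T / (4 * lam) := by gcongr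
end

section
/- (Bretagnolle–Huber inequality.) Let P and Q be probability measures on a measurable space and let E be a measurable set. Then P(Eᶜ) + Q(E) ≥ (1/2)·exp(−D(P‖Q)), where D(P‖Q) denotes the Kullback–Leibler divergence of P from Q (taken in nats, and interpreted as +∞ when P is not absolutely continuous with respect to Q, in which case the inequality is trivial). -/
open MeasureTheory
open scoped Classical
open scoped ENNReal

/-- The Kullback–Leibler divergence `D(P‖Q)` (in nats), as an extended real:
`∫ log(dP/dQ) dP` when `P ≪ Q` (and the log-likelihood ratio is integrable),
and `+∞` otherwise. -/
noncomputable def klDiv {α : Type*} [MeasurableSpace α] (P Q : Measure α) : EReal :=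
  if P ≪ Q ∧ Integrable (llr P Q) P then ((∫ x, llr P Q x ∂P : ℝ) : EReal) else ⊤

/-- The tangent-line form of Gibbs' inequality on a measurable set. -/
lemma neg_setIntegral_llr_le {α : Type*} [MeasurableSpace α] {P Q : Measure α}
    [IsFiniteMeasure P] [IsFiniteMeasure Q] (hPQ : P ≪ Q) (hint : Integrable (llr P Q) P)
    (A : Set α) {s : ℝ} (hs : 0 < s) :
    -∫ x in A, llr P Q x ∂P ≤ Q.real A / s + P.real A * (Real.log s - 1) := by
  have hle : ∫ x in A, (-llr P Q x + (1 - Real.log s)) ∂P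
      ≤ ∫ x in A, (Q.rnDeriv P x).toReal / s ∂P := by
    refine integral_mono_ae (hint.neg.integrableOn.add (integrable_const _))
      (Measure.integrable_toReal_rnDeriv.integrableOn.div_const s) (ae_restrict_of_ae ?_)
    filter_upwards [exp_neg_llr hPQ] with x hx
    have h := Real.add_one_le_exp (-llr P Q x - Real.log s)
    rw [Real.exp_sub, Real.exp_log hs, hx] at h
    linarith
  rw [integral_add (f := fun x ↦ -llr P Q x) hint.neg.integrableOn (integrable_const _),
    integral_neg, integral_div,
    setIntegral_const, smul_eq_mul] at hle
  have hQ : (∫ x in A, (Q.rnDeriv P x).toReal ∂P) / s ≤ Q.real A / s :=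
    div_le_div_of_nonneg_right (Measure.setIntegral_toReal_rnDeriv_le (measure_ne_top Q A)) hs.le
  linarith

/-- The Bretagnolle–Huber inequality in terms of real-valued integrals. -/
lemma exp_neg_integral_llr_le {α : Type*} [MeasurableSpace α] {P Q : Measure α}
    [IsProbabilityMeasure P] [IsProbabilityMeasure Q] (hPQ : P ≪ Q)
    (hint : Integrable (llr P Q) P) {E : Set α} (hE : MeasurableSet E) :
    Real.exp (-∫ x, llr P Q x ∂P) ≤ 2 * (P.real Eᶜ + Q.real E) := by
  have hP : P.real Eᶜ + P.real E = 1 := by rw [probReal_compl_eq_one_sub hE]; ring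
  have hQ : Q.real Eᶜ = 1 - Q.real E := probReal_compl_eq_one_sub hE
  have ha : 0 ≤ P.real Eᶜ := measureReal_nonneg
  have hb : 0 ≤ Q.real E := measureReal_nonneg
  have hu : 0 < P.real Eᶜ + Q.real E := by
    by_contra! h
    have hQE : Q.real E = 0 := by linarith
    have hPE : P.real E = 0 := by
      rw [measureReal_eq_zero_iff] at hQE ⊢
      exact hPQ hQE
    linarith
  have h1 := neg_setIntegral_llr_le hPQ hint E (s := 2 * (P.real Eᶜ + Q.real E)) (by linarith)
  have h2 := neg_setIntegral_llr_le hPQ hint Eᶜ (s := 2) two_pos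
  have hsplit := integral_add_compl hE hint
  rw [← Real.le_log_iff_exp_le (by linarith)]
  rw [hQ] at h2
  rw [← hsplit]
  have hPE : P.real E = 1 - P.real Eᶜ := by linarith
  rw [hPE] at h1
  generalize P.real Eᶜ = a at *
  generalize Q.real E = b at *
  have hlog : Real.log (2 * (a + b)) = Real.log 2 + Real.log (a + b) :=
    Real.log_mul two_ne_zero hu.ne'
  have htan : -Real.log (a + b) ≤ 1 / (2 * (a + b)) - 1 + Real.log 2 := by
    have h := Real.log_le_sub_one_of_pos (x := 1 / (2 * (a + b))) (by positivity)
    rw [one_div, Real.log_inv, hlog] at h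
    rw [one_div]
    linarith
  have hmul := mul_le_mul_of_nonneg_left htan ha
  have hfrac : b / (2 * (a + b)) + a * (1 / (2 * (a + b))) = 1 / 2 := by field_simp; ring
  have hlog2 : a * Real.log 2 ≤ a * 1 :=
    mul_le_mul_of_nonneg_left (by linarith [Real.log_two_lt_d9]) ha
  rw [hlog] at h1 ⊢
  linarith

/-- Bretagnolle–Huber inequality: for probability measures `P, Q` and any measurable
set `E`, `P(Eᶜ) + Q(E) ≥ (1/2)·exp(−D(P‖Q))` (the right-hand side being `0` when
`D(P‖Q) = +∞`, in which case the inequality is trivial). -/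
theorem stmt_6 {α : Type*} [MeasurableSpace α] (P Q : Measure α)
    [IsProbabilityMeasure P] [IsProbabilityMeasure Q]
    (E : Set α) (hE : MeasurableSet E) :
    (1 / 2 : ℝ≥0∞) * EReal.exp (-(klDiv P Q)) ≤ P Eᶜ + Q E := by
  unfold klDiv
  split_ifs with h
  · rw [← EReal.coe_neg, EReal.exp_coe, ← ofReal_measureReal (μ := P),
      ← ofReal_measureReal (μ := Q),
      ← ENNReal.ofReal_add measureReal_nonneg measureReal_nonneg]
    calc (1 / 2 : ℝ≥0∞) * ENNReal.ofReal (Real.exp (-∫ x, llr P Q x ∂P))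
        ≤ (1 / 2 : ℝ≥0∞) * ENNReal.ofReal (2 * (P.real Eᶜ + Q.real E)) := by
          gcongr
          exact exp_neg_integral_llr_le h.1 h.2 hE
      _ = ENNReal.ofReal (P.real Eᶜ + Q.real E) := by
          rw [ENNReal.ofReal_mul zero_le_two, ENNReal.ofReal_ofNat, ← mul_assoc, one_div,
            ENNReal.inv_mul_cancel two_ne_zero ENNReal.ofNat_ne_top, one_mul]
  · simp
end

section
/- Let x and β be reals with 1/4 ≤ x, 0 < β ≤ 1/4 and x + β ≤ 3/4. Let P be the Bernoulli measure with mean x and Q the Bernoulli measure with mean x + β. Then the Kullback–Leibler divergence satisfies D(P ‖ Q) ≤ 8β²/ln 2. -/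
open MeasureTheory
open scoped Classical

/-- The Bernoulli probability measure on `Bool` with success probability `p`. -/
noncomputable def bernoulliMeasure (p : ℝ) : Measure Bool :=
  ENNReal.ofReal p • Measure.dirac true + ENNReal.ofReal (1 - p) • Measure.dirac false

/-- At an atom of the reference measure, the log-likelihood ratio is the logarithm of the
quotient of the masses. -/
lemma llr_eq_log_div_of_singleton {α : Type*} [MeasurableSpace α] [MeasurableSingletonClass α]
    {P Q : Measure α} [IsFiniteMeasure P] [IsFiniteMeasure Q] (hPQ : P ≪ Q) {a : α}
    (ha : Q {a} ≠ 0) : llr P Q a = Real.log (P.real {a} / Q.real {a}) := by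
  have h : P.rnDeriv Q a * Q {a} = P {a} := by
    rw [← lintegral_singleton, Measure.setLIntegral_rnDeriv hPQ]
  have hQ : Q.real {a} ≠ 0 := (measureReal_ne_zero_iff (measure_ne_top Q {a})).2 ha
  rw [llr]
  congr 1
  rw [eq_div_iff hQ, measureReal_def, measureReal_def, ← ENNReal.toReal_mul, h]

instance isFiniteMeasure_bernoulliMeasure (p : ℝ) : IsFiniteMeasure (bernoulliMeasure p) :=
  ⟨by simp [bernoulliMeasure]⟩

lemma bernoulliMeasure_singleton_true (p : ℝ) :
    bernoulliMeasure p {true} = ENNReal.ofReal p := by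
  simp [bernoulliMeasure]

lemma bernoulliMeasure_singleton_false (p : ℝ) :
    bernoulliMeasure p {false} = ENNReal.ofReal (1 - p) := by
  simp [bernoulliMeasure]

lemma absolutelyContinuous_bernoulliMeasure (p : ℝ) {q : ℝ} (hq0 : 0 < q) (hq1 : q < 1) :
    bernoulliMeasure p ≪ bernoulliMeasure q := by
  intro s hs
  have hs' : s = ∅ := by
    refine Set.eq_empty_of_forall_notMem fun b hb => ?_
    have h0 : bernoulliMeasure q {b} = 0 :=
      measure_mono_null (Set.singleton_subset_iff.2 hb) hs
    cases b
    · rw [bernoulliMeasure_singleton_false, ENNReal.ofReal_eq_zero] at h0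
      linarith
    · rw [bernoulliMeasure_singleton_true, ENNReal.ofReal_eq_zero] at h0
      linarith
  simp [hs']

/-- The divergence of two Bernoulli measures with means in `(0, 1)`. -/
lemma klDiv_bernoulliMeasure {p q : ℝ} (hp0 : 0 < p) (hp1 : p < 1) (hq0 : 0 < q) (hq1 : q < 1) :
    klDiv (bernoulliMeasure p) (bernoulliMeasure q) =
      ((p * Real.log (p / q) + (1 - p) * Real.log ((1 - p) / (1 - q)) : ℝ) : EReal) := by
  have hac := absolutelyContinuous_bernoulliMeasure p hq0 hq1
  have hint : Integrable (llr (bernoulliMeasure p) (bernoulliMeasure q)) (bernoulliMeasure p) :=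
    Integrable.of_finite
  have ht : bernoulliMeasure q {true} ≠ 0 := by
    simpa [bernoulliMeasure_singleton_true] using hq0
  have hf : bernoulliMeasure q {false} ≠ 0 := by
    simpa [bernoulliMeasure_singleton_false] using hq1
  rw [klDiv, if_pos ⟨hac, hint⟩, integral_fintype hint, Fintype.sum_bool,
    llr_eq_log_div_of_singleton hac ht, llr_eq_log_div_of_singleton hac hf]
  simp only [measureReal_def, bernoulliMeasure_singleton_true, bernoulliMeasure_singleton_false,
    ENNReal.toReal_ofReal hp0.le, ENNReal.toReal_ofReal hq0.le,
    ENNReal.toReal_ofReal (sub_nonneg.2 hp1.le), ENNReal.toReal_ofReal (sub_nonneg.2 hq1.le),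
    smul_eq_mul]

/-- The divergence of two Bernoulli distributions is at most their `χ²`-divergence. -/
lemma bernoulli_divergence_le_chiSq {p q : ℝ} (hp0 : 0 < p) (hp1 : p < 1) (hq0 : 0 < q)
    (hq1 : q < 1) :
    p * Real.log (p / q) + (1 - p) * Real.log ((1 - p) / (1 - q)) ≤
      (q - p) ^ 2 / (q * (1 - q)) := by
  have hp1' : 0 < 1 - p := sub_pos.2 hp1
  have hq1' : 0 < 1 - q := sub_pos.2 hq1
  calc p * Real.log (p / q) + (1 - p) * Real.log ((1 - p) / (1 - q))
      ≤ p * (p / q - 1) + (1 - p) * ((1 - p) / (1 - q) - 1) := by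
        gcongr
        · exact Real.log_le_sub_one_of_pos (by positivity)
        · exact Real.log_le_sub_one_of_pos (by positivity)
    _ = (q - p) ^ 2 / (q * (1 - q)) := by
        field_simp
        ring

/-- Quadratic bound on the divergence of two close Bernoulli distributions:
for `1/4 ≤ x`, `0 < β ≤ 1/4`, `x + β ≤ 3/4`,
`D(Bernoulli(x) ‖ Bernoulli(x+β)) ≤ 8β²/ln 2`. -/
theorem stmt_8 (x β : ℝ) (hx : 1 / 4 ≤ x) (hβ0 : 0 < β) (hβ : β ≤ 1 / 4)
    (hxβ : x + β ≤ 3 / 4) :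
    klDiv (bernoulliMeasure x) (bernoulliMeasure (x + β)) ≤
      ((8 * β ^ 2 / Real.log 2 : ℝ) : EReal) := by
  rw [klDiv_bernoulliMeasure (by linarith) (by linarith) (by linarith) (by linarith),
    EReal.coe_le_coe_iff]
  have hvar : 1 / 8 ≤ (x + β) * (1 - (x + β)) := by nlinarith
  have hlog : 0 < Real.log 2 := Real.log_pos one_lt_two
  have hlog1 : Real.log 2 ≤ 1 := by linarith [Real.log_two_lt_d9]
  calc _ ≤ (x + β - x) ^ 2 / ((x + β) * (1 - (x + β))) :=
        bernoulli_divergence_le_chiSq (by linarith) (by linarith) (by linarith) (by linarith)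
    _ = β ^ 2 / ((x + β) * (1 - (x + β))) := by rw [add_sub_cancel_left]
    _ ≤ β ^ 2 / (1 / 8) := by gcongr
    _ = 8 * β ^ 2 / 1 := by ring
    _ ≤ 8 * β ^ 2 / Real.log 2 := by gcongr
end

section
/- (Prediction problem lower bound.) Let x and β be reals with 1/4 ≤ x, 0 < β ≤ 1/4 and x + β ≤ 3/4, and let γ ∈ (0, 1/4). Let P^{⊗n} and Q^{⊗n} be the n-fold product measures on {0,1}^n of the Bernoulli measures with means x and x + β respectively. If there exists a measurable set E ⊆ {0,1}^n with P^{⊗n}(Eᶜ) ≤ γ and Q^{⊗n}(E) ≤ γ, then n ≥ (ln 2/(8β²)) · ln(1/(4γ)). Consequently, any procedure that distinguishes Bernoulli(x) from Bernoulli(x+β) from n i.i.d. samples with success probability at least 1 − γ under both hypotheses requires n ≥ (ln 2/(8β²)) · ln(1/(4γ)) samples. -/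
open MeasureTheory

instance bernoulliMeasure.instIsFiniteMeasure (p : ℝ) :
    IsFiniteMeasure (bernoulliMeasure p) := by
  constructor
  simp [bernoulliMeasure]

lemma bernoulliMeasure_real_singleton {p : ℝ} (h0 : 0 ≤ p) (h1 : p ≤ 1) (b : Bool) :
    (bernoulliMeasure p).real {b} = if b then p else 1 - p := by
  cases b <;> simp [bernoulliMeasure, measureReal_def, h0, h1]

lemma isProbabilityMeasure_bernoulliMeasure {p : ℝ} (h0 : 0 ≤ p) (h1 : p ≤ 1) :
    IsProbabilityMeasure (bernoulliMeasure p) := by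
  constructor
  simp [bernoulliMeasure, ← ENNReal.ofReal_add h0 (sub_nonneg.2 h1)]

lemma measureReal_pi_singleton {ι : Type*} [Fintype ι] {α : ι → Type*}
    [∀ i, MeasurableSpace (α i)] (μ : ∀ i, Measure (α i)) [∀ i, SigmaFinite (μ i)]
    (ω : ∀ i, α i) : (Measure.pi μ).real {ω} = ∏ i, (μ i).real {ω i} := by
  simp [measureReal_def, Measure.pi_singleton, ENNReal.toReal_prod]

/-- Cauchy–Schwarz bound of the Bhattacharyya sum over a set by the masses of the set. -/
lemma sum_sqrt_mul_measureReal_singleton_le {Ω : Type*} [MeasurableSpace Ω]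
    [MeasurableSingletonClass Ω] (P Q : Measure Ω) [IsFiniteMeasure P] [IsFiniteMeasure Q]
    (s : Finset Ω) :
    ∑ ω ∈ s, √(P.real {ω} * Q.real {ω}) ≤ √(P.real s * Q.real s) := by
  rw [← sum_measureReal_singleton (μ := P) s, ← sum_measureReal_singleton (μ := Q) s,
    Real.sqrt_mul (Finset.sum_nonneg fun _ _ => measureReal_nonneg)]
  simp_rw [Real.sqrt_mul measureReal_nonneg]
  exact Real.sum_sqrt_mul_sqrt_le s (fun _ => measureReal_nonneg) (fun _ => measureReal_nonneg)

/-- Two probability measures separated by a test with both errors at most `γ` have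
Bhattacharyya coefficient at most `2 √γ`. -/
lemma sum_sqrt_mul_measureReal_singleton_le_two_mul_sqrt {Ω : Type*} [Fintype Ω]
    [MeasurableSpace Ω] [MeasurableSingletonClass Ω] (P Q : Measure Ω)
    [IsProbabilityMeasure P] [IsProbabilityMeasure Q] {γ : ℝ} {E : Set Ω}
    (hP : P.real Eᶜ ≤ γ) (hQ : Q.real E ≤ γ) :
    ∑ ω, √(P.real {ω} * Q.real {ω}) ≤ 2 * √γ := by
  classical
  have hE := sum_sqrt_mul_measureReal_singleton_le P Q E.toFinset
  have hEc := sum_sqrt_mul_measureReal_singleton_le P Q E.toFinsetᶜ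
  rw [Finset.coe_compl, Set.coe_toFinset] at hEc
  rw [Set.coe_toFinset] at hE
  have h1 : √(P.real E * Q.real E) ≤ √γ := Real.sqrt_le_sqrt <|
    (mul_le_of_le_one_left measureReal_nonneg measureReal_le_one).trans hQ
  have h2 : √(P.real Eᶜ * Q.real Eᶜ) ≤ √γ := Real.sqrt_le_sqrt <|
    (mul_le_of_le_one_right measureReal_nonneg measureReal_le_one).trans hP
  rw [← Finset.sum_add_sum_compl E.toFinset]
  linarith

/-- Tensorization of the Bhattacharyya coefficient. -/
lemma sum_sqrt_mul_measureReal_pi_singleton {α : Type*} [Fintype α] [MeasurableSpace α]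
    (μ ν : Measure α) [SigmaFinite μ] [SigmaFinite ν] (n : ℕ) :
    ∑ ω : Fin n → α, √((Measure.pi fun _ => μ).real {ω} * (Measure.pi fun _ => ν).real {ω}) =
      (∑ a, √(μ.real {a} * ν.real {a})) ^ n := by
  simp_rw [Fintype.sum_pow, measureReal_pi_singleton, ← Finset.prod_mul_distrib]
  refine Finset.sum_congr rfl fun ω _ => ?_
  exact Real.sqrt_prod _ fun _ _ => mul_nonneg measureReal_nonneg measureReal_nonneg

lemma midpoint_sub_sq_le_sqrt_mul {x β : ℝ} (hx : 1 / 4 ≤ x) (hβ0 : 0 ≤ β) (hβ : β ≤ 1 / 4) :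
    x + β / 2 - β ^ 2 ≤ √(x * (x + β)) := by
  apply Real.le_sqrt_of_sq_le
  nlinarith [mul_nonneg hβ0 (sub_nonneg.2 hβ), mul_nonneg (sq_nonneg β) (sub_nonneg.2 hx),
    mul_nonneg (sq_nonneg β) hβ0, mul_nonneg (sq_nonneg β) (mul_nonneg hβ0 (sub_nonneg.2 hβ)),
    mul_nonneg (sq_nonneg β) (sub_nonneg.2 hβ)]

lemma exp_neg_four_mul_sq_le_bhattacharyya {x β : ℝ} (hx : 1 / 4 ≤ x) (hβ0 : 0 ≤ β)
    (hβ : β ≤ 1 / 4) (hxβ : x + β ≤ 3 / 4) :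
    Real.exp (-(4 * β ^ 2)) ≤ √(x * (x + β)) + √((1 - x) * (1 - (x + β))) := by
  have h1 := midpoint_sub_sq_le_sqrt_mul hx hβ0 hβ
  have h2 := midpoint_sub_sq_le_sqrt_mul (x := 1 - (x + β)) (by linarith) hβ0 hβ
  rw [show (1 - (x + β)) * (1 - (x + β) + β) = (1 - x) * (1 - (x + β)) by ring] at h2
  have h3 : Real.exp (-(4 * β ^ 2)) ≤ 1 - 2 * β ^ 2 := by
    have hsq : β ^ 2 ≤ 1 / 16 := by nlinarith
    rw [Real.exp_neg, inv_le_iff_one_le_mul₀ (Real.exp_pos _)]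
    nlinarith [Real.add_one_le_exp (4 * β ^ 2), sq_nonneg β]
  linarith

/-- Prediction problem lower bound: if a decision set `E ⊆ {0,1}ⁿ` distinguishes
`Bernoulli(x)` from `Bernoulli(x+β)` with error probability at most `γ` under both
hypotheses (i.e. `P^{⊗n}(Eᶜ) ≤ γ` and `Q^{⊗n}(E) ≤ γ`), then
`n ≥ (ln 2/(8β²))·ln(1/(4γ))`. -/
theorem stmt_9 (x β : ℝ) (hx : 1 / 4 ≤ x) (hβ0 : 0 < β) (hβ : β ≤ 1 / 4)
    (hxβ : x + β ≤ 3 / 4) (γ : ℝ) (hγ : γ ∈ Set.Ioo (0 : ℝ) (1 / 4))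
    (n : ℕ) (E : Set (Fin n → Bool)) (hE : MeasurableSet E)
    (hPE : (Measure.pi fun _ : Fin n => bernoulliMeasure x) Eᶜ ≤ ENNReal.ofReal γ)
    (hQE : (Measure.pi fun _ : Fin n => bernoulliMeasure (x + β)) E ≤ ENNReal.ofReal γ) :
    (Real.log 2 / (8 * β ^ 2)) * Real.log (1 / (4 * γ)) ≤ (n : ℝ) := by
  obtain ⟨hγ0, -⟩ := hγ
  have := isProbabilityMeasure_bernoulliMeasure (p := x) (by linarith) (by linarith)
  have := isProbabilityMeasure_bernoulliMeasure (p := x + β) (by linarith) (by linarith)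
  have hBC := sum_sqrt_mul_measureReal_singleton_le_two_mul_sqrt _ _
    (ENNReal.toReal_le_of_le_ofReal hγ0.le hPE) (ENNReal.toReal_le_of_le_ofReal hγ0.le hQE)
  rw [sum_sqrt_mul_measureReal_pi_singleton, Fintype.sum_bool] at hBC
  simp_rw [bernoulliMeasure_real_singleton (p := x) (by linarith) (by linarith),
    bernoulliMeasure_real_singleton (p := x + β) (by linarith) (by linarith)] at hBC
  simp only [if_true, Bool.false_eq_true, if_false] at hBC
  have hexp : Real.exp (-(4 * β ^ 2)) ^ n ≤ 2 * √γ :=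
    (pow_le_pow_left₀ (Real.exp_pos _).le
      (exp_neg_four_mul_sq_le_bhattacharyya hx hβ0.le hβ hxβ) n).trans hBC
  have hexp2 : Real.exp (-(8 * β ^ 2 * n)) ≤ 4 * γ := by
    calc Real.exp (-(8 * β ^ 2 * n)) = (Real.exp (-(4 * β ^ 2)) ^ n) ^ 2 := by
          rw [← Real.exp_nat_mul, ← Real.exp_nat_mul]; push_cast; ring_nf
      _ ≤ (2 * √γ) ^ 2 := pow_le_pow_left₀ (by positivity) hexp 2
      _ = 4 * γ := by rw [mul_pow, Real.sq_sqrt hγ0.le]; norm_num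
  have hlog : Real.log (1 / (4 * γ)) ≤ 8 * β ^ 2 * n := by
    have := (Real.le_log_iff_exp_le (by positivity)).2 hexp2
    rw [one_div, Real.log_inv]
    linarith
  have hlog2 : Real.log 2 ≤ 1 := by linarith [Real.log_two_lt_d9]
  calc Real.log 2 / (8 * β ^ 2) * Real.log (1 / (4 * γ))
      ≤ Real.log 2 / (8 * β ^ 2) * (8 * β ^ 2 * n) := by gcongr
    _ = Real.log 2 * n := by field_simp
    _ ≤ n := mul_le_of_le_one_left n.cast_nonneg hlog2
end

section
/- Let μ ≥ 0, A > 0, T > 1 and ε > 0 be reals with T^{ε/3} ≥ 2, and let m ≥ 1 be a natural number. Then μ·∑_{i=1}^{m} A·T^{(2/3)iε} − ∑_{i=1}^{m} (A·T^{(2/3)iε})² / (T^{iε}/2) ≥ μ·A·T^{(2/3)mε} − 2·A²·T^{(m+1)ε/3}. In particular, if in each phase i = 1, …, m an algorithm obtains A·T^{(2/3)iε} equally spaced samples in a phase of duration at least T^{iε}/2 from an arm of mean μ, its total payoff over the learning period is at least μ·A·T^{(2/3)mε} − 2·A²·T^{(m+1)ε/3}. -/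
/-- For `2 ≤ x`, the geometric sum `x + x² + ⋯ + xᵐ` is at most `xᵐ⁺¹`. -/
theorem sum_Icc_pow_le_pow_succ {x : ℝ} (hx : 2 ≤ x) (m : ℕ) :
    ∑ i ∈ Finset.Icc 1 m, x ^ i ≤ x ^ (m + 1) := by
  induction m with
  | zero => simp; linarith
  | succ k ih =>
    rw [Finset.sum_Icc_succ_top (by omega)]
    have hpow : 0 ≤ x ^ (k + 1) := by positivity
    calc _ ≤ x ^ (k + 1) + x ^ (k + 1) := by gcongr
      _ ≤ x ^ (k + 1) * x := by nlinarith
      _ = x ^ (k + 1 + 1) := (pow_succ _ _).symm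

/-- Payoff lower bound for the learning period of the CTSAB algorithm: if in each
phase `i = 1, …, m` the algorithm obtains `A·T^{(2/3)iε}` equally spaced samples
in a phase of duration at least `T^{iε}/2` from an arm of mean `μ`, then
`μ·∑ A·T^{(2/3)iε} − ∑ (A·T^{(2/3)iε})²/(T^{iε}/2)
  ≥ μ·A·T^{(2/3)mε} − 2·A²·T^{(m+1)ε/3}`. -/
theorem stmt_15 (μ A T ε : ℝ) (hμ : 0 ≤ μ) (hA : 0 < A) (hT : 1 < T) (hε : 0 < ε)
    (hTε : 2 ≤ T ^ (ε / 3)) (m : ℕ) (hm : 1 ≤ m) :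
    μ * (A * T ^ ((2 / 3) * m * ε)) - 2 * A ^ 2 * T ^ ((m + 1) * ε / 3) ≤
      μ * ∑ i ∈ Finset.Icc 1 m, A * T ^ ((2 / 3) * i * ε) -
        ∑ i ∈ Finset.Icc 1 m, (A * T ^ ((2 / 3) * i * ε)) ^ 2 / (T ^ (i * ε) / 2) := by
  have hT0 : 0 < T := by linarith
  have hrpow (n : ℕ) (y : ℝ) (hy : y = ε / 3 * n) : T ^ y = (T ^ (ε / 3)) ^ n := by
    rw [hy, Real.rpow_mul_natCast hT0.le]
  have hcost : ∑ i ∈ Finset.Icc 1 m, (A * T ^ ((2 / 3) * i * ε)) ^ 2 / (T ^ (i * ε) / 2) =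
      2 * A ^ 2 * ∑ i ∈ Finset.Icc 1 m, (T ^ (ε / 3)) ^ i := by
    rw [Finset.mul_sum]
    refine Finset.sum_congr rfl fun i _ => ?_
    rw [hrpow (2 * i) ((2 / 3) * i * ε) (by push_cast; ring),
      hrpow (3 * i) (i * ε) (by push_cast; ring)]
    have hx : T ^ (ε / 3) ≠ 0 := by positivity
    field_simp
    ring
  have hlast : A * T ^ ((2 / 3) * m * ε) ≤
      ∑ i ∈ Finset.Icc 1 m, A * T ^ ((2 / 3) * i * ε) :=
    Finset.single_le_sum (f := fun i : ℕ => A * T ^ ((2 / 3) * (i : ℝ) * ε))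
      (fun i _ => by positivity) (Finset.mem_Icc.2 ⟨hm, le_rfl⟩)
  rw [hcost, hrpow (m + 1) ((m + 1) * ε / 3) (by push_cast; ring)]
  gcongr
  exact sum_Icc_pow_le_pow_succ hTε m
end
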